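/- arXiv:0811.1770 — 4 statements merged into one kernel-verified Lean document; each statement's English description precedes it below -/
import Mathlib

section
/- Let W₁,…,W_k be symmetric B-DMCs with symmetric mutual informations I₁,…,I_k, and let W^{[k]} be the product channel W^{[k]}(y₁^k | x) = ∏_{i=1}^k W_i(y_i | x). For each i, let ε_i ∈ [0, 1/2] be the unique value with h(ε_i) = 1 − I_i, and let W_BSC^{[k]} be the product channel of the binary symmetric channels BSC(ε₁),…,BSC(ε_k). Then I(W^{[k]}) ≥ I(W_BSC^{[k]}). -/
open scoped BigOperators

/-- A binary-input DMC with finite output alphabet `Y`. -/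
def IsBDMC {Y : Type} [Fintype Y] (W : ZMod 2 → Y → ℝ) : Prop :=
  (∀ x y, 0 ≤ W x y) ∧ ∀ x, ∑ y, W x y = 1

/-- Symmetry of a B-DMC. -/
def IsSymmetricBDMC {Y : Type} [Fintype Y] (W : ZMod 2 → Y → ℝ) : Prop :=
  ∃ π : Y → Y, Function.Involutive π ∧ ∀ y, W 1 y = W 0 (π y)

/-- Symmetric mutual information `I(W)` (base-2 logarithm). -/
noncomputable def mutualInfo {Y : Type} [Fintype Y] (W : ZMod 2 → Y → ℝ) : ℝ :=
  ∑ y, ∑ x : ZMod 2,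
    (1 / 2) * W x y * Real.logb 2 (W x y / ((1 / 2) * W 0 y + (1 / 2) * W 1 y))

/-- Bhattacharyya parameter `Z(W)`. -/
noncomputable def bhatt {Y : Type} [Fintype Y] (W : ZMod 2 → Y → ℝ) : ℝ :=
  ∑ y, Real.sqrt (W 0 y * W 1 y)

/-- The split channel `W^{(i)}` (here `i : Fin m` is 0-based). -/
noncomputable def splitChannel {Y : Type} [Fintype Y] {m : ℕ}
    (W : ZMod 2 → Y → ℝ) (G : Matrix (Fin m) (Fin m) (ZMod 2)) (i : Fin m) :
    ZMod 2 → ((Fin m → Y) × (Fin i.val → ZMod 2)) → ℝ :=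
  fun ui z =>
    (1 / 2 ^ (m - 1)) *
      ∑ u ∈ Finset.univ.filter
          (fun u : Fin m → ZMod 2 =>
            u i = ui ∧ ∀ j : Fin i.val, u (Fin.castLE i.isLt.le j) = z.2 j),
        ∏ j, W (Matrix.vecMul u G j) (z.1 j)

/-- The channel `W^k` (k independent uses of `W` with the same input). -/
noncomputable def prodChannel {Y : Type} [Fintype Y] (W : ZMod 2 → Y → ℝ) (k : ℕ) :
    ZMod 2 → (Fin k → Y) → ℝ :=
  fun x y => ∏ j, W x (y j)

def IsUpperTriangular {l : ℕ} (M : Matrix (Fin l) (Fin l) (ZMod 2)) : Prop :=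
  ∀ i j : Fin l, j < i → M i j = 0

/-- `G` is polarizing: invertible and no column permutation is upper triangular. -/
def IsPolarizing {l : ℕ} (G : Matrix (Fin l) (Fin l) (ZMod 2)) : Prop :=
  IsUnit G.det ∧
    ∀ σ : Equiv.Perm (Fin l), ¬ IsUpperTriangular (Matrix.of fun i j => G i (σ j))

/-- `n`-th Kronecker power of `G`, as an `ℓ^n × ℓ^n` matrix. -/
def kronPow {l : ℕ} (G : Matrix (Fin l) (Fin l) (ZMod 2)) :
    (n : ℕ) → Matrix (Fin (l ^ n)) (Fin (l ^ n)) (ZMod 2)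
  | 0 => 1
  | n + 1 =>
      Matrix.reindex (finProdFinEquiv.trans (finCongr (pow_succ' l n).symm))
        (finProdFinEquiv.trans (finCongr (pow_succ' l n).symm))
        (Matrix.kroneckerMap (· * ·) G (kronPow G n))

/-- The binary symmetric channel with crossover probability `ε`. -/
noncomputable def BSC (ε : ℝ) : ZMod 2 → ZMod 2 → ℝ :=
  fun x y => if y = x then 1 - ε else ε

/-- The binary entropy function (base-2). -/
noncomputable def binEnt (p : ℝ) : ℝ :=
  -(p * Real.logb 2 p) - (1 - p) * Real.logb 2 (1 - p)

namespace BinaryChannel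

open Real

/-- The logarithmic ratio `log ((1 + t) / (1 - t))`, that is `2 * artanh t`. -/
noncomputable def logRatio (t : ℝ) : ℝ := log (1 + t) - log (1 - t)

lemma logRatio_zero : logRatio 0 = 0 := by simp [logRatio]

lemma logRatio_one_sub_two_mul {x : ℝ} (h0 : 0 < x) (h1 : x < 1) :
    logRatio (1 - 2 * x) = log (1 - x) - log x := by
  have e1 : 1 + (1 - 2 * x) = 2 * (1 - x) := by ring
  have e2 : 1 - (1 - 2 * x) = 2 * x := by ring
  rw [logRatio, e1, e2, log_mul two_ne_zero (by linarith), log_mul two_ne_zero h0.ne']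
  ring

lemma two_mul_le_logRatio {t : ℝ} (h0 : 0 ≤ t) (h1 : t < 1) : 2 * t ≤ logRatio t := by
  have h := hasSum_log_sub_log_of_abs_lt_one (x := t) (by rw [abs_of_nonneg h0]; exact h1)
  have := sum_le_hasSum {0} (fun i _ => by positivity) h
  simpa [logRatio] using this

lemma logRatio_pos {t : ℝ} (h0 : 0 < t) (h1 : t < 1) : 0 < logRatio t := by
  linarith [two_mul_le_logRatio h0.le h1]

lemma hasDerivAt_logRatio {t : ℝ} (h0 : 0 ≤ t) (h1 : t < 1) :
    HasDerivAt logRatio (2 / (1 - t ^ 2)) t := by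
  have a : HasDerivAt (fun t : ℝ => 1 + t) 1 t := (hasDerivAt_id t).const_add 1
  have b : HasDerivAt (fun t : ℝ => 1 - t) (-1) t := (hasDerivAt_id t).const_sub 1
  have n1 : 1 + t ≠ 0 := by linarith
  have n2 : 1 - t ≠ 0 := by linarith
  have n3 : 1 - t ^ 2 ≠ 0 := by nlinarith
  refine ((a.log n1).sub (b.log n2)).congr_deriv ?_
  field_simp
  ring

lemma antitoneOn_inv_sub_mul_logRatio :
    AntitoneOn (fun t : ℝ => (t⁻¹ - t) * logRatio t) (Set.Ioo 0 1) := by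
  have hd : ∀ t ∈ Set.Ioo (0 : ℝ) 1, HasDerivAt (fun t : ℝ => (t⁻¹ - t) * logRatio t)
      ((-(t ^ 2)⁻¹ - 1) * logRatio t + (t⁻¹ - t) * (2 / (1 - t ^ 2))) t := fun t ht =>
    ((hasDerivAt_inv ht.1.ne').sub (hasDerivAt_id t)).mul (hasDerivAt_logRatio ht.1.le ht.2)
  refine antitoneOn_of_deriv_nonpos (convex_Ioo 0 1)
    (fun t ht => (hd t ht).continuousAt.continuousWithinAt)
    (fun t ht => ?_) (fun t ht => ?_)
  · rw [interior_Ioo] at ht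
    exact (hd t ht).differentiableAt.differentiableWithinAt
  · rw [interior_Ioo] at ht
    rw [(hd t ht).deriv]
    obtain ⟨h0, h1⟩ := ht
    have n3 : 1 - t ^ 2 ≠ 0 := by nlinarith
    have e : (t⁻¹ - t) * (2 / (1 - t ^ 2)) = (t ^ 2)⁻¹ * (2 * t) := by
      field_simp
    have hA := two_mul_le_logRatio h0.le h1
    have hi : 0 < (t ^ 2)⁻¹ := by positivity
    rw [e]
    nlinarith

/-- For `0 ≤ c ≤ 1`, the quotient `artanh (c * t) / artanh t` is antitone on `(0, 1)`. -/
lemma logRatio_mul_le {c s t : ℝ} (hc0 : 0 ≤ c) (hc1 : c ≤ 1) (hs : 0 < s) (hst : s ≤ t)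
    (ht : t < 1) : logRatio (c * t) * logRatio s ≤ logRatio (c * s) * logRatio t := by
  rcases hc0.eq_or_lt with rfl | hc
  · simp [logRatio_zero]
  have hct : ∀ t ∈ Set.Ioo (0 : ℝ) 1, c * t ∈ Set.Ioo (0 : ℝ) 1 := fun t ht =>
    ⟨mul_pos hc ht.1, by nlinarith [ht.1, ht.2]⟩
  have hd : ∀ t ∈ Set.Ioo (0 : ℝ) 1, HasDerivAt (fun t : ℝ => logRatio (c * t) / logRatio t)
      ((2 / (1 - (c * t) ^ 2) * c * logRatio t - logRatio (c * t) * (2 / (1 - t ^ 2)))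
        / logRatio t ^ 2) t := fun t ht => by
    have h1 := hasDerivAt_logRatio (hct t ht).1.le (hct t ht).2
    have h2 : HasDerivAt (fun t : ℝ => c * t) c t := by
      simpa using (hasDerivAt_id t).const_mul c
    exact (h1.comp t h2).div (hasDerivAt_logRatio ht.1.le ht.2) (logRatio_pos ht.1 ht.2).ne'
  have anti : AntitoneOn (fun t : ℝ => logRatio (c * t) / logRatio t) (Set.Ioo 0 1) := by
    refine antitoneOn_of_deriv_nonpos (convex_Ioo 0 1)
      (fun t ht => (hd t ht).continuousAt.continuousWithinAt)
      (fun t ht => ?_) (fun t ht => ?_)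
    · rw [interior_Ioo] at ht
      exact (hd t ht).differentiableAt.differentiableWithinAt
    · rw [interior_Ioo] at ht
      rw [(hd t ht).deriv]
      refine div_nonpos_of_nonpos_of_nonneg ?_ (sq_nonneg _)
      have hle : c * t ≤ t := mul_le_of_le_one_left ht.1.le hc1
      have hu := antitoneOn_inv_sub_mul_logRatio (hct t ht) ht hle
      obtain ⟨h0, h1⟩ := ht
      obtain ⟨h0', h1'⟩ := hct t ⟨h0, h1⟩
      have p1 : 0 < 1 - t ^ 2 := by nlinarith
      have p2 : 0 < 1 - (c * t) ^ 2 := by nlinarith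
      have e : 2 / (1 - (c * t) ^ 2) * c * logRatio t - logRatio (c * t) * (2 / (1 - t ^ 2))
          = 2 * c * t / ((1 - (c * t) ^ 2) * (1 - t ^ 2)) *
            ((t⁻¹ - t) * logRatio t - ((c * t)⁻¹ - c * t) * logRatio (c * t)) := by
        rw [mul_pow] at p2 ⊢
        field_simp
      rw [e]
      exact mul_nonpos_of_nonneg_of_nonpos (by positivity) (sub_nonpos.2 hu)
  have h := anti ⟨hs, hst.trans_lt ht⟩ ⟨hs.trans_le hst, ht⟩ hst
  exact (div_le_div_iff₀ (logRatio_pos (hs.trans_le hst) ht)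
    (logRatio_pos hs (hst.trans_lt ht))).1 h

/-- Crossover probability of the cascade of two binary symmetric channels. -/
def cascade (p e : ℝ) : ℝ := p * (1 - e) + (1 - p) * e

lemma cascade_one_sub_left (p e : ℝ) : cascade (1 - p) e = 1 - cascade p e := by
  unfold cascade; ring

lemma cascade_one_sub_right (p e : ℝ) : cascade p (1 - e) = 1 - cascade p e := by
  unfold cascade; ring

lemma le_cascade_left {p e : ℝ} (hp : p ≤ 1 / 2) (he : 0 ≤ e) : p ≤ cascade p e := by
  unfold cascade; nlinarith

lemma le_cascade_right {p e : ℝ} (hp : 0 ≤ p) (he : e ≤ 1 / 2) : e ≤ cascade p e := by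
  unfold cascade; nlinarith

lemma cascade_le_half {p e : ℝ} (hp : p ≤ 1 / 2) (he : e ≤ 1 / 2) : cascade p e ≤ 1 / 2 := by
  unfold cascade; nlinarith

lemma cascade_half (p : ℝ) : cascade p (1 / 2) = 1 / 2 := by unfold cascade; ring

lemma binEntropy_mono {x y : ℝ} (hx : 0 ≤ x) (hxy : x ≤ y) (hy : y ≤ 1 / 2) :
    binEntropy x ≤ binEntropy y :=
  binEntropy_strictMonoOn.monotoneOn ⟨hx, by norm_num at *; linarith⟩
    ⟨hx.trans hxy, by norm_num at *; linarith⟩ hxy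

lemma hasDerivAt_binEntropy_cascade {p e : ℝ} (h0 : 0 < cascade p e) (h1 : cascade p e < 1) :
    HasDerivAt (fun e => binEntropy (cascade p e))
      ((1 - 2 * p) * logRatio (1 - 2 * cascade p e)) e := by
  have hc : HasDerivAt (cascade p) (1 - 2 * p) e := by
    have := (((hasDerivAt_id e).const_sub 1).const_mul p).add
      ((hasDerivAt_id e).const_mul (1 - p))
    exact this.congr_deriv (by ring)
  rw [logRatio_one_sub_two_mul h0 h1, mul_comm]
  exact (hasDerivAt_binEntropy h0.ne' h1.ne).comp e hc

lemma exists_slope_of_mem_Ioo {p ε : ℝ} (hp0 : 0 ≤ p) (hp : p ≤ 1 / 2) (hε0 : 0 < ε)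
    (hε : ε < 1 / 2) : ∃ l : ℝ, ∀ e, 0 ≤ e → e ≤ 1 / 2 →
      binEntropy (cascade p ε) - l * binEntropy ε ≤
        binEntropy (cascade p e) - l * binEntropy e := by
  set c := 1 - 2 * p with hc
  have hcas : ∀ e, 1 - 2 * cascade p e = c * (1 - 2 * e) := fun e => by
    unfold cascade; rw [hc]; ring
  set l := c * logRatio (1 - 2 * cascade p ε) / logRatio (1 - 2 * ε) with hl
  have hLε : 0 < logRatio (1 - 2 * ε) := logRatio_pos (by linarith) (by linarith)
  have hd : ∀ e ∈ Set.Ioo (0 : ℝ) (1 / 2),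
      HasDerivAt (fun e => binEntropy (cascade p e) - l * binEntropy e)
        (c * logRatio (1 - 2 * cascade p e) - l * logRatio (1 - 2 * e)) e := fun e he => by
    have h1 := le_cascade_right hp0 he.2.le
    have h2 := cascade_le_half hp he.2.le
    refine (hasDerivAt_binEntropy_cascade (by linarith [he.1]) (by linarith)).sub
      (HasDerivAt.const_mul l ?_)
    rw [logRatio_one_sub_two_mul he.1 (by linarith [he.2])]
    exact hasDerivAt_binEntropy he.1.ne' (by linarith [he.2])
  have hcont : Continuous (fun e => binEntropy (cascade p e) - l * binEntropy e) := by
    have : Continuous (cascade p) := by unfold cascade; fun_prop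
    exact (binEntropy_continuous.comp this).sub (continuous_const.mul binEntropy_continuous)
  have hc0 : 0 ≤ c := by linarith
  have hc1 : c ≤ 1 := by linarith
  refine ⟨l, fun e he0 he => ?_⟩
  rcases le_total e ε with hle | hle
  · have anti : AntitoneOn (fun e => binEntropy (cascade p e) - l * binEntropy e)
        (Set.Icc 0 ε) := by
      refine antitoneOn_of_deriv_nonpos (convex_Icc 0 ε) hcont.continuousOn
        (fun x hx => ?_) (fun x hx => ?_) <;> rw [interior_Icc] at hx
      · exact (hd x ⟨hx.1, hx.2.trans hε⟩).differentiableAt.differentiableWithinAt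
      · rw [(hd x ⟨hx.1, hx.2.trans hε⟩).deriv, hl, sub_nonpos, div_mul_eq_mul_div,
          le_div_iff₀ hLε, mul_assoc, mul_assoc]
        refine mul_le_mul_of_nonneg_left ?_ hc0
        rw [hcas, hcas]
        exact logRatio_mul_le hc0 hc1 (by linarith) (by linarith [hx.2]) (by linarith [hx.1])
    exact anti ⟨he0, hle⟩ ⟨hε0.le, le_rfl⟩ hle
  · have mono : MonotoneOn (fun e => binEntropy (cascade p e) - l * binEntropy e)
        (Set.Icc ε (1 / 2)) := by
      refine monotoneOn_of_deriv_nonneg (convex_Icc ε (1 / 2)) hcont.continuousOn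
        (fun x hx => ?_) (fun x hx => ?_) <;> rw [interior_Icc] at hx
      · exact (hd x ⟨hε0.trans hx.1, hx.2⟩).differentiableAt.differentiableWithinAt
      · rw [(hd x ⟨hε0.trans hx.1, hx.2⟩).deriv, hl, sub_nonneg, div_mul_eq_mul_div,
          div_le_iff₀ hLε, mul_assoc, mul_assoc]
        refine mul_le_mul_of_nonneg_left ?_ hc0
        rw [hcas, hcas]
        exact logRatio_mul_le hc0 hc1 (by linarith [hx.2]) (by linarith [hx.1]) (by linarith)
    exact mono ⟨le_rfl, hε.le⟩ ⟨hle, he⟩ hle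

/-- Convexity behind Mrs. Gerber's lemma, in supporting-line form: `binEntropy (cascade p e)`
as a function of `binEntropy e` has a supporting line at every `ε ∈ [0, 1/2]`. -/
lemma exists_slope {p ε : ℝ} (hp0 : 0 ≤ p) (hp1 : p ≤ 1) (hε0 : 0 ≤ ε) (hε : ε ≤ 1 / 2) :
    ∃ l : ℝ, ∀ e, 0 ≤ e → e ≤ 1 →
      binEntropy (cascade p ε) - l * binEntropy ε ≤
        binEntropy (cascade p e) - l * binEntropy e := by
  wlog hp : p ≤ 1 / 2 generalizing p
  · have := this (p := 1 - p) (by linarith) (by linarith) (by linarith)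
    simpa only [cascade_one_sub_left, binEntropy_one_sub] using this
  suffices h : ∃ l : ℝ, ∀ e, 0 ≤ e → e ≤ 1 / 2 →
      binEntropy (cascade p ε) - l * binEntropy ε ≤
        binEntropy (cascade p e) - l * binEntropy e by
    obtain ⟨l, h⟩ := h
    refine ⟨l, fun e he0 he1 => ?_⟩
    rcases le_total e (1 / 2) with he | he
    · exact h e he0 he
    · have := h (1 - e) (by linarith) (by linarith)
      rwa [cascade_one_sub_right, binEntropy_one_sub, binEntropy_one_sub] at this
  rcases hε0.eq_or_lt with rfl | hε0
  · refine ⟨0, fun e he0 he => ?_⟩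
    have h0 : cascade p 0 = p := by unfold cascade; ring
    simpa [h0] using
      binEntropy_mono hp0 (le_cascade_left hp he0) (cascade_le_half hp he)
  rcases hε.eq_or_lt with rfl | hε
  · refine ⟨1, fun e he0 he => ?_⟩
    rw [cascade_half]
    linarith [binEntropy_mono he0 (le_cascade_right hp0 he) (cascade_le_half hp he)]
  exact exists_slope_of_mem_Ioo hp0 hp hε0 hε

/-- Contribution (in nats) to the symmetric mutual information of an output letter with
transition probabilities `a` and `b`. -/
noncomputable def infoTerm (a b : ℝ) : ℝ :=
  negMulLog ((a + b) / 2) - negMulLog a / 2 - negMulLog b / 2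

lemma infoTerm_mul (s a b : ℝ) : infoTerm (s * a) (s * b) = s * infoTerm a b := by
  have : (s * a + s * b) / 2 = s * ((a + b) / 2) := by ring
  rw [infoTerm, infoTerm, this, negMulLog_mul, negMulLog_mul, negMulLog_mul]
  ring

lemma infoTerm_one_sub (e : ℝ) :
    infoTerm (1 - e) e = (log 2 - binEntropy e) / 2 := by
  have : (1 - e + e) / 2 = (2 : ℝ)⁻¹ := by ring
  rw [infoTerm, this, binEntropy_eq_negMulLog_add_negMulLog_one_sub, negMulLog, log_inv]
  ring

lemma mutualInfo_mul_log_two {Y : Type} [Fintype Y] {W : ZMod 2 → Y → ℝ}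
    (hW : ∀ x y, 0 ≤ W x y) :
    mutualInfo W * log 2 = ∑ y, infoTerm (W 0 y) (W 1 y) := by
  have hl : log 2 ≠ 0 := (log_pos one_lt_two).ne'
  have key : ∀ x m : ℝ, (x ≠ 0 → 0 < m) →
      1 / 2 * x * logb 2 (x / m) * log 2 = -negMulLog x / 2 - x / 2 * log m := by
    intro x m hm
    rcases eq_or_ne x 0 with rfl | h
    · simp
    · rw [logb, log_div h (hm h).ne', negMulLog]
      field_simp
  rw [mutualInfo, Finset.sum_mul]
  refine Finset.sum_congr rfl fun y _ => ?_
  have h0 := hW 0 y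
  have h1 := hW 1 y
  have e2 : ∀ f : ZMod 2 → ℝ, ∑ x, f x = f 0 + f 1 := Fin.sum_univ_two
  rw [e2, add_mul, key, key, infoTerm]
  · have : 1 / 2 * W 0 y + 1 / 2 * W 1 y = (W 0 y + W 1 y) / 2 := by ring
    rw [this, negMulLog.eq_def ((W 0 y + W 1 y) / 2)]
    ring
  · intro h
    have := h1.lt_of_ne' h
    positivity
  · intro h
    have := h0.lt_of_ne' h
    positivity

/-- The information carried by `BSC(e)` combined with an output letter `(a, b)`. -/
lemma infoTerm_add_eq {T p : ℝ} (e : ℝ) :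
    infoTerm (T * p * (1 - e)) (T * (1 - p) * e) + infoTerm (T * p * e) (T * (1 - p) * (1 - e)) =
      T / 2 * (binEntropy (cascade p e) - binEntropy e) +
        (negMulLog (T / 2) - negMulLog T / 2 - T / 2 * binEntropy p) := by
  have e1 : (T * p * (1 - e) + T * (1 - p) * e) / 2 = T / 2 * cascade p e := by
    unfold cascade; ring
  have e2 : (T * p * e + T * (1 - p) * (1 - e)) / 2 = T / 2 * (1 - cascade p e) := by
    unfold cascade; ring
  simp only [infoTerm, e1, e2, negMulLog_mul, binEntropy_eq_negMulLog_add_negMulLog_one_sub]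
  ring

lemma exists_slope_infoTerm {a b ε : ℝ} (ha : 0 ≤ a) (hb : 0 ≤ b) (hε0 : 0 ≤ ε)
    (hε : ε ≤ 1 / 2) : ∃ l : ℝ, ∀ e, 0 ≤ e → e ≤ 1 →
      infoTerm (a * (1 - ε)) (b * ε) + infoTerm (a * ε) (b * (1 - ε))
          + l * (binEntropy e - binEntropy ε) ≤
        infoTerm (a * (1 - e)) (b * e) + infoTerm (a * e) (b * (1 - e)) := by
  obtain ⟨T, p, hT, hp0, hp1, rfl, rfl⟩ : ∃ T p : ℝ, 0 ≤ T ∧ 0 ≤ p ∧ p ≤ 1 ∧ a = T * p ∧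
      b = T * (1 - p) := by
    rcases (add_nonneg ha hb).eq_or_lt with h | h
    · exact ⟨0, 0, le_rfl, le_rfl, zero_le_one, by linarith, by linarith⟩
    · refine ⟨a + b, a / (a + b), h.le, by positivity, ?_, ?_, ?_⟩
      · rw [div_le_one h]; linarith
      · field_simp
      · field_simp; ring
  obtain ⟨l, hl⟩ := exists_slope hp0 hp1 hε0 hε
  refine ⟨T / 2 * (l - 1), fun e he0 he1 => ?_⟩
  rw [infoTerm_add_eq, infoTerm_add_eq]
  nlinarith [mul_le_mul_of_nonneg_left (hl e he0 he1) (by positivity : 0 ≤ T / 2)]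

lemma sum_infoTerm_ge_bsc {Y : Type} [Fintype Y] {W : ZMod 2 → Y → ℝ} (hW : IsBDMC W)
    (hsym : IsSymmetricBDMC W) {ε : ℝ} (hε : ε ∈ Set.Icc (0 : ℝ) (1 / 2))
    (hεI : binEnt ε = 1 - mutualInfo W) {a b : ℝ} (ha : 0 ≤ a) (hb : 0 ≤ b) :
    ∑ x : ZMod 2, infoTerm (a * BSC ε 0 x) (b * BSC ε 1 x) ≤
      ∑ y, infoTerm (a * W 0 y) (b * W 1 y) := by
  obtain ⟨σ, hσ, hσW⟩ := hsym
  have hσ0 : ∀ y, W 0 y = W 1 (σ y) := fun y => by rw [hσW, hσ y]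
  obtain ⟨l, hl⟩ := exists_slope_infoTerm ha hb hε.1 hε.2
  -- Each letter is a scaled output of a binary symmetric channel.
  have hdec : ∀ y, ∃ s e : ℝ, 0 ≤ s ∧ 0 ≤ e ∧ e ≤ 1 ∧ W 0 y = s * (1 - e) ∧ W 1 y = s * e := by
    intro y
    have h0 := hW.1 0 y
    have h1 := hW.1 1 y
    rcases (add_nonneg h0 h1).eq_or_lt with h | h
    · exact ⟨0, 0, le_rfl, le_rfl, zero_le_one, by linarith, by linarith⟩
    · refine ⟨W 0 y + W 1 y, W 1 y / (W 0 y + W 1 y), h.le, by positivity, ?_, ?_, ?_⟩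
      · rw [div_le_one h]; linarith
      · field_simp; ring
      · field_simp
  choose s e hs he0 he1 hW0 hW1 using hdec
  have hsum : ∑ y, s y = 2 := by
    have : ∀ y, s y = W 0 y + W 1 y := fun y => by rw [hW0, hW1]; ring
    simp only [this, Finset.sum_add_distrib, hW.2]
    norm_num
  have hent : ∑ y, s y * binEntropy (e y) = 2 * binEntropy ε := by
    have h1 := mutualInfo_mul_log_two hW.1
    have h2 : ∀ y, infoTerm (W 0 y) (W 1 y) = s y * (log 2 / 2) - s y * binEntropy (e y) / 2 :=
      fun y => by rw [hW0, hW1, infoTerm_mul, infoTerm_one_sub]; ring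
    simp only [h2, Finset.sum_sub_distrib, ← Finset.sum_mul, ← Finset.sum_div, hsum] at h1
    have h3 : binEnt ε * log 2 = binEntropy ε := by
      have hl : log 2 ≠ 0 := (log_pos one_lt_two).ne'
      rw [binEnt, binEntropy_eq_negMulLog_add_negMulLog_one_sub, negMulLog, negMulLog, logb, logb]
      field_simp
      ring
    rw [hεI] at h3
    linarith
  have hswap : ∑ y, infoTerm (a * W 0 y) (b * W 1 y) =
      ∑ y, infoTerm (a * W 1 y) (b * W 0 y) := by
    rw [← Equiv.sum_comp hσ.toPerm]
    refine Finset.sum_congr rfl fun y _ => ?_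
    simp only [Function.Involutive.coe_toPerm]
    rw [← hσW, ← hσ0]
  have hB : ∑ x : ZMod 2, infoTerm (a * BSC ε 0 x) (b * BSC ε 1 x) =
      infoTerm (a * (1 - ε)) (b * ε) + infoTerm (a * ε) (b * (1 - ε)) := by
    have e2 : ∀ f : ZMod 2 → ℝ, ∑ x, f x = f 0 + f 1 := Fin.sum_univ_two
    rw [e2]
    simp [BSC]
  set B := infoTerm (a * (1 - ε)) (b * ε) + infoTerm (a * ε) (b * (1 - ε))
  have hterm : ∀ y, s y * (B - l * binEntropy ε) + l * (s y * binEntropy (e y)) ≤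
      infoTerm (a * W 0 y) (b * W 1 y) + infoTerm (a * W 1 y) (b * W 0 y) := by
    intro y
    have e1 : infoTerm (a * W 0 y) (b * W 1 y) =
        s y * infoTerm (a * (1 - e y)) (b * e y) := by
      rw [← infoTerm_mul, hW0, hW1]; congr 1 <;> ring
    have e2 : infoTerm (a * W 1 y) (b * W 0 y) =
        s y * infoTerm (a * e y) (b * (1 - e y)) := by
      rw [← infoTerm_mul, hW0, hW1]; congr 1 <;> ring
    rw [e1, e2]
    linarith [mul_le_mul_of_nonneg_left (hl (e y) (he0 y) (he1 y)) (hs y)]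
  have hall := Finset.sum_le_sum fun y (_ : y ∈ Finset.univ) => hterm y
  simp only [Finset.sum_add_distrib, ← Finset.sum_mul, ← Finset.mul_sum, hsum, hent] at hall
  rw [hB]
  linarith

lemma BSC_nonneg {ε : ℝ} (hε : ε ∈ Set.Icc (0 : ℝ) (1 / 2)) (x y : ZMod 2) : 0 ≤ BSC ε x y := by
  unfold BSC
  split_ifs <;> linarith [hε.1, hε.2]

lemma sum_infoTerm_prod_ge_bsc {k : ℕ} (Y : Fin k → Type) [∀ i, Fintype (Y i)]
    (W : (i : Fin k) → ZMod 2 → Y i → ℝ)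
    (hW : ∀ i, IsBDMC (W i)) (hsym : ∀ i, IsSymmetricBDMC (W i))
    (ε : Fin k → ℝ) (hε : ∀ i, ε i ∈ Set.Icc (0 : ℝ) (1 / 2))
    (hεI : ∀ i, binEnt (ε i) = 1 - mutualInfo (W i)) {a b : ℝ} (ha : 0 ≤ a) (hb : 0 ≤ b) :
    ∑ x : Fin k → ZMod 2, infoTerm (a * ∏ i, BSC (ε i) 0 (x i)) (b * ∏ i, BSC (ε i) 1 (x i)) ≤
      ∑ y : (i : Fin k) → Y i, infoTerm (a * ∏ i, W i 0 (y i)) (b * ∏ i, W i 1 (y i)) := by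
  induction k generalizing a b with
  | zero => simp
  | succ k ih =>
    rw [← Equiv.sum_comp (Fin.consEquiv fun _ => ZMod 2), ← Equiv.sum_comp (Fin.consEquiv Y),
      Fintype.sum_prod_type_right, Fintype.sum_prod_type]
    simp only [Fin.consEquiv_apply, Fin.prod_univ_succ, Fin.cons_zero, Fin.cons_succ]
    have hstep : ∀ y₀ : Y 0, _ := fun y₀ =>
      ih (fun i => Y i.succ) (fun i => W i.succ) (fun i => hW _) (fun i => hsym _)
        (fun i => ε i.succ) (fun i => hε _) (fun i => hεI _)
        (mul_nonneg ha ((hW 0).1 0 y₀)) (mul_nonneg hb ((hW 0).1 1 y₀))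
    have htail := Finset.sum_le_sum fun y₀ (_ : y₀ ∈ Finset.univ) => hstep y₀
    rw [Finset.sum_comm] at htail
    simp only [← mul_assoc]
    refine le_trans (Finset.sum_le_sum fun x _ => ?_) htail
    have hP : ∀ u, 0 ≤ ∏ i : Fin k, BSC (ε i.succ) u (x i) := fun u =>
      Finset.prod_nonneg fun i _ => BSC_nonneg (hε _) _ _
    have := sum_infoTerm_ge_bsc (hW 0) (hsym 0) (hε 0) (hεI 0)
      (mul_nonneg ha (hP 0)) (mul_nonneg hb (hP 1))
    simpa only [mul_right_comm] using this

end BinaryChannel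

/-- Among symmetric B-DMCs with prescribed mutual informations, BSCs minimize
the mutual information of the product channel: `I(W^{[k]}) ≥ I(W_BSC^{[k]})`, where
`ε_i ∈ [0,1/2]` satisfies `h(ε_i) = 1 - I(W_i)`. -/
theorem mutualInfo_prod_ge_bsc {k : ℕ} (Y : Fin k → Type) [∀ i, Fintype (Y i)]
    (W : (i : Fin k) → ZMod 2 → Y i → ℝ)
    (hW : ∀ i, IsBDMC (W i)) (hsym : ∀ i, IsSymmetricBDMC (W i))
    (ε : Fin k → ℝ) (hε : ∀ i, ε i ∈ Set.Icc (0 : ℝ) (1 / 2))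
    (hεI : ∀ i, binEnt (ε i) = 1 - mutualInfo (W i)) :
    mutualInfo (fun x (y : (i : Fin k) → Y i) => ∏ i, W i x (y i)) ≥
      mutualInfo (fun x (y : Fin k → ZMod 2) => ∏ i, BSC (ε i) x (y i)) := by
  have hlog : 0 < Real.log 2 := Real.log_pos one_lt_two
  refine le_of_mul_le_mul_right ?_ hlog
  rw [BinaryChannel.mutualInfo_mul_log_two fun x y =>
      Finset.prod_nonneg fun i _ => BinaryChannel.BSC_nonneg (hε i) _ _,
    BinaryChannel.mutualInfo_mul_log_two fun x y => Finset.prod_nonneg fun i _ => (hW i).1 _ _]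
  simpa using
    BinaryChannel.sum_infoTerm_prod_ge_bsc Y W hW hsym ε hε hεI zero_le_one zero_le_one
end

section
/- For every ε ∈ [0, 1/2], the two-fold product channel BSC(ε)² (two independent uses of BSC(ε) with the same input bit) satisfies I(BSC(ε)²) = 1 + h(2ε(1−ε)) − 2h(ε). -/
open scoped BigOperators

lemma sum_zmod_two {M : Type*} [AddCommMonoid M] (f : ZMod 2 → M) : ∑ x, f x = f 0 + f 1 :=
  Fin.sum_univ_two f

lemma sum_fin_two_arrow {α M : Type*} [Fintype α] [AddCommMonoid M] (f : (Fin 2 → α) → M) :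
    ∑ y, f y = ∑ a, ∑ b, f ![a, b] := by
  rw [← (finTwoArrowEquiv α).symm.sum_comp, Fintype.sum_prod_type]
  rfl

lemma mutualInfo_bsc_sq_eq_logb (ε : ℝ) :
    mutualInfo (prodChannel (BSC ε) 2) =
      (1 - ε) ^ 2 * Real.logb 2 ((1 - ε) ^ 2 / (((1 - ε) ^ 2 + ε ^ 2) / 2)) +
        ε ^ 2 * Real.logb 2 (ε ^ 2 / (((1 - ε) ^ 2 + ε ^ 2) / 2)) := by
  have hmix : Real.logb 2
      ((1 - ε) * ε / ((1 / 2) * ((1 - ε) * ε) + (1 / 2) * ((1 - ε) * ε))) = 0 := by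
    rw [← add_mul, show (1 / 2 + 1 / 2 : ℝ) = 1 by norm_num, one_mul]
    by_cases h : (1 - ε) * ε = 0
    · simp [h]
    · simp [div_self h]
  have h00 : BSC ε 0 0 = 1 - ε := by simp [BSC]
  have h01 : BSC ε 0 1 = ε := by simp [BSC]
  have h10 : BSC ε 1 0 = ε := by simp [BSC]
  have h11 : BSC ε 1 1 = 1 - ε := by simp [BSC]
  simp only [mutualInfo, prodChannel, sum_fin_two_arrow, sum_zmod_two, Fin.prod_univ_two,
    Matrix.cons_val_zero, Matrix.cons_val_one, h00, h01, h10, h11,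
    mul_comm ε (1 - ε), hmix]
  rw [show 1 / 2 * ((1 - ε) * (1 - ε)) + 1 / 2 * (ε * ε) = ((1 - ε) ^ 2 + ε ^ 2) / 2 by ring,
    show 1 / 2 * (ε * ε) + 1 / 2 * ((1 - ε) * (1 - ε)) = ((1 - ε) ^ 2 + ε ^ 2) / 2 by ring,
    ← sq, ← sq]
  ring

/-- For `ε ∈ [0, 1/2]`, `I(BSC(ε)²) = 1 + h(2ε(1-ε)) - 2h(ε)`. -/
theorem mutualInfo_bsc_sq {ε : ℝ} (hε : ε ∈ Set.Icc (0 : ℝ) (1 / 2)) :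
    mutualInfo (prodChannel (BSC ε) 2) = 1 + binEnt (2 * ε * (1 - ε)) - 2 * binEnt ε := by
  obtain ⟨h0, h1⟩ := hε
  rw [mutualInfo_bsc_sq_eq_logb]
  rcases h0.eq_or_lt with rfl | hpos
  · simp [binEnt]
  have ha : 1 - ε ≠ 0 := by linarith
  have hs : (1 - ε) ^ 2 + ε ^ 2 ≠ 0 := by positivity
  simp only [binEnt]
  rw [show 1 - 2 * ε * (1 - ε) = (1 - ε) ^ 2 + ε ^ 2 by ring,
    Real.logb_div (pow_ne_zero 2 ha) (by positivity),
    Real.logb_div (pow_ne_zero 2 hpos.ne') (by positivity),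
    Real.logb_div hs two_ne_zero, Real.logb_mul (by positivity) ha,
    Real.logb_mul two_ne_zero hpos.ne', Real.logb_pow, Real.logb_pow,
    Real.logb_self_eq_one one_lt_two]
  push_cast
  ring
end

section
/- Let W be a symmetric B-DMC and G an invertible ℓ×ℓ matrix over GF(2), and let k be the number of 1s in the last row of G. Then the split channel W^{(ℓ)} defined from W and G satisfies I(W^{(ℓ)}) = I(W^k) and Z(W^{(ℓ)}) = Z(W)^k. -/
open scoped BigOperators

/-- The sum over outputs of a function of the two transition probabilities. -/
def outputSum {Y : Type} [Fintype Y] (f : ℝ → ℝ → ℝ) (W : ZMod 2 → Y → ℝ) : ℝ :=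
  ∑ y, f (W 0 y) (W 1 y)

/-- The contribution of one output, with transition probabilities `a` and `b`, to the symmetric
mutual information. -/
noncomputable def mutualInfoTerm (a b : ℝ) : ℝ :=
  (1 / 2) * a * Real.logb 2 (a / ((1 / 2) * a + (1 / 2) * b)) +
    (1 / 2) * b * Real.logb 2 (b / ((1 / 2) * a + (1 / 2) * b))

theorem mutualInfo_eq_outputSum {Y : Type} [Fintype Y] (W : ZMod 2 → Y → ℝ) :
    mutualInfo W = outputSum mutualInfoTerm W :=
  Finset.sum_congr rfl fun _ _ => Fin.sum_univ_two _

theorem mutualInfoTerm_mul (c a b : ℝ) :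
    mutualInfoTerm (c * a) (c * b) = c * mutualInfoTerm a b := by
  rcases eq_or_ne c 0 with rfl | hc
  · simp [mutualInfoTerm]
  · have h (x : ℝ) : c * x / ((1 / 2) * (c * a) + (1 / 2) * (c * b)) =
        x / ((1 / 2) * a + (1 / 2) * b) := by
      rw [← mul_div_mul_left x _ hc]
      ring_nf
    simp only [mutualInfoTerm, h]
    ring

theorem sqrt_mul_mul_mul {c : ℝ} (hc : 0 ≤ c) (a b : ℝ) :
    √(c * a * (c * b)) = c * √(a * b) := by
  rw [mul_mul_mul_comm, Real.sqrt_mul (mul_self_nonneg c), Real.sqrt_mul_self hc]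

theorem bhatt_prodChannel {Y : Type} [Fintype Y] {W : ZMod 2 → Y → ℝ}
    (hW : ∀ x y, 0 ≤ W x y) (k : ℕ) : bhatt (prodChannel W k) = bhatt W ^ k := by
  simp only [bhatt, prodChannel, ← Finset.prod_mul_distrib]
  simp only [Real.sqrt_prod Finset.univ fun j _ => mul_nonneg (hW 0 _) (hW 1 _)]
  exact (Fintype.sum_pow (fun y => √(W 0 y * W 1 y)) k).symm

/-- The input vector with coordinates `p` below `i` and `x` from `i` on. -/
def prefixVec {m : ℕ} (i : Fin m) (p : Fin i.val → ZMod 2) (x : ZMod 2) : Fin m → ZMod 2 :=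
  fun j => if h : j.val < i.val then p ⟨j, h⟩ else x

theorem splitChannel_of_isTop {Y : Type} [Fintype Y] {m : ℕ} (W : ZMod 2 → Y → ℝ)
    (G : Matrix (Fin m) (Fin m) (ZMod 2)) {i : Fin m} (hi : IsTop i) (x : ZMod 2)
    (y : Fin m → Y) (p : Fin i.val → ZMod 2) :
    splitChannel W G i x (y, p) =
      (1 / 2 ^ (m - 1)) * ∏ j, W (Matrix.vecMul (prefixVec i p 0) G j + x * G i j) (y j) := by
  have hu : Finset.univ.filter (fun u : Fin m → ZMod 2 =>
      u i = x ∧ ∀ j : Fin i.val, u (Fin.castLE i.isLt.le j) = p j) = {prefixVec i p x} := by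
    ext u
    simp only [Finset.mem_filter, Finset.mem_univ, true_and, Finset.mem_singleton]
    constructor
    · rintro ⟨hx, hp⟩
      ext1 j
      unfold prefixVec
      split_ifs with h
      · exact hp ⟨j, h⟩
      · rw [← hx, le_antisymm (hi j) (not_lt.1 h)]
    · rintro rfl
      simp [prefixVec]
  have hadd : prefixVec i p x = prefixVec i p 0 + Pi.single i x := by
    ext1 j
    rcases (hi j).lt_or_eq with h | rfl
    · simp [prefixVec, h, h.ne]
    · simp [prefixVec]
  simp only [splitChannel]
  rw [hu, Finset.sum_singleton, hadd, Matrix.add_vecMul]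
  simp [Matrix.single_vecMul]

/-- Adding a fixed vector to the inputs of independent uses of a symmetric channel permutes the
outputs. -/
theorem exists_perm_prod_add {Y : Type} [Fintype Y] {ι : Type} [Fintype ι]
    {W : ZMod 2 → Y → ℝ} (hsym : IsSymmetricBDMC W) (v : ι → ZMod 2) :
    ∃ e : Equiv.Perm (ι → Y), ∀ (x : ι → ZMod 2) (y : ι → Y),
      ∏ j, W (v j + x j) (y j) = ∏ j, W (x j) (e y j) := by
  obtain ⟨π, hπ, h⟩ := hsym
  have key : ∀ a : ZMod 2, ∃ e : Equiv.Perm Y, ∀ x y, W (a + x) y = W x (e y) := by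
    have h' (y : Y) : W 0 y = W 1 (π y) := by rw [h, hπ]
    intro a
    fin_cases a
    · exact ⟨Equiv.refl Y, fun x y => congrArg (W · y) (zero_add x)⟩
    · refine ⟨hπ.toPerm, fun x y => ?_⟩
      fin_cases x
      · exact h y
      · exact h' y
  choose e he using key
  exact ⟨Equiv.piCongrRight fun j => e (v j), fun x y => by simp [he]⟩

/-- Independent uses of a channel with inputs `0` carry no information. -/
theorem sum_prod_mul_eq_outputSum_prodChannel {Y : Type} [Fintype Y] {ι : Type} [Fintype ι]
    [DecidableEq ι] {f : ℝ → ℝ → ℝ} (hf : ∀ c a b, 0 ≤ c → f (c * a) (c * b) = c * f a b)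
    {W : ZMod 2 → Y → ℝ} (hW : IsBDMC W) (g : ι → ZMod 2) :
    ∑ y : ι → Y, f (∏ j, W 0 (y j)) (∏ j, W (g j) (y j)) =
      outputSum f (prodChannel W (Finset.univ.filter fun j => g j = 1).card) := by
  let e := Equiv.piEquivPiSubtypeProd (fun j => g j = 1) (fun _ : ι => Y)
  have hsplit (x : ι → ZMod 2) (q : ({j // g j = 1} → Y) × ({j // ¬ g j = 1} → Y)) :
      ∏ j, W (x j) (e.symm q j) =
        (∏ j : {j // ¬ g j = 1}, W (x j) (q.2 j)) * ∏ j : {j // g j = 1}, W (x j) (q.1 j) := by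
    rw [mul_comm, ← Fintype.prod_subtype_mul_prod_subtype (fun j => g j = 1)]
    congr 1 <;> refine Finset.prod_congr rfl fun j _ => ?_ <;>
      simp [e, Equiv.piEquivPiSubtypeProd, j.2]
  have hzero (a : ZMod 2) (ha : ¬ a = 1) : a = 0 := by
    revert a; decide
  have hone : ∑ r : {j // ¬ g j = 1} → Y, ∏ j, W 0 (r j) = 1 := by
    rw [← Fintype.prod_sum (fun (_ : {j // ¬ g j = 1}) (y : Y) => W 0 y)]
    simp [hW.2]
  let s : {j // g j = 1} ≃ Fin (Finset.univ.filter fun j => g j = 1).card :=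
    Fintype.equivFinOfCardEq (Fintype.card_subtype _)
  calc ∑ y : ι → Y, f (∏ j, W 0 (y j)) (∏ j, W (g j) (y j))
      = ∑ q : ({j // g j = 1} → Y) × ({j // ¬ g j = 1} → Y),
          (∏ j, W 0 (q.2 j)) * f (∏ j, W 0 (q.1 j)) (∏ j, W 1 (q.1 j)) := by
        rw [← e.symm.sum_comp]
        refine Finset.sum_congr rfl fun q _ => ?_
        rw [hsplit (fun _ => 0), hsplit g, ← hf _ _ _ (Finset.prod_nonneg fun _ _ => hW.1 _ _)]
        congr 2 <;> refine Finset.prod_congr rfl fun j _ => ?_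
        · rw [hzero _ j.2]
        · rw [j.2]
    _ = ∑ q : {j // g j = 1} → Y, f (∏ j, W 0 (q j)) (∏ j, W 1 (q j)) := by
        rw [Fintype.sum_prod_type]
        simp only [← Finset.sum_mul, hone, one_mul]
    _ = _ := by
        unfold outputSum prodChannel
        rw [← (s.arrowCongr (Equiv.refl Y)).symm.sum_comp]
        refine Finset.sum_congr rfl fun q _ => ?_
        congr 1 <;> exact s.prod_comp fun j => W _ (q j)

theorem outputSum_splitChannel_of_isTop {Y : Type} [Fintype Y] {m : ℕ}
    {f : ℝ → ℝ → ℝ} (hf : ∀ c a b, 0 ≤ c → f (c * a) (c * b) = c * f a b)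
    {W : ZMod 2 → Y → ℝ} (hW : IsBDMC W) (hsym : IsSymmetricBDMC W)
    (G : Matrix (Fin m) (Fin m) (ZMod 2)) {i : Fin m} (hi : IsTop i) :
    outputSum f (splitChannel W G i) =
      outputSum f (prodChannel W (Finset.univ.filter fun j => G i j = 1).card) := by
  have hm : m - 1 = i.val := by
    have h : m - 1 ≤ i.val := hi ⟨m - 1, by have := i.isLt; omega⟩
    omega
  rw [outputSum, Fintype.sum_prod_type_right]
  have hp (p : Fin i.val → ZMod 2) :
      ∑ y : Fin m → Y, f (splitChannel W G i 0 (y, p)) (splitChannel W G i 1 (y, p)) =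
        1 / 2 ^ (m - 1) *
          outputSum f (prodChannel W (Finset.univ.filter fun j => G i j = 1).card) := by
    obtain ⟨e, he⟩ := exists_perm_prod_add hsym (Matrix.vecMul (prefixVec i p 0) G)
    simp only [splitChannel_of_isTop W G hi, hf _ _ _ (by positivity : (0 : ℝ) ≤ 1 / 2 ^ (m - 1))]
    rw [← Finset.mul_sum, ← sum_prod_mul_eq_outputSum_prodChannel hf hW]
    simp only [zero_mul, one_mul, he (fun _ => 0), he (G i)]
    rw [Equiv.sum_comp e fun y => f (∏ j, W 0 (y j)) (∏ j, W (G i j) (y j))]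
  simp [hp, hm]

/-- If the last row of an invertible `G` has `k` ones, then the last split
channel is equivalent to `W^k`: `I(W^{(ℓ)}) = I(W^k)` and `Z(W^{(ℓ)}) = Z(W)^k`. -/
theorem splitChannel_last_eq_prodChannel {Y : Type} [Fintype Y] {l : ℕ} (hl : 0 < l)
    (W : ZMod 2 → Y → ℝ) (hW : IsBDMC W) (hsym : IsSymmetricBDMC W)
    (G : Matrix (Fin l) (Fin l) (ZMod 2)) (hGinv : IsUnit G.det)
    (k : ℕ)
    (hk : k = (Finset.univ.filter (fun j : Fin l => G ⟨l - 1, by omega⟩ j = 1)).card) :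
    mutualInfo (splitChannel W G ⟨l - 1, by omega⟩) = mutualInfo (prodChannel W k) ∧
      bhatt (splitChannel W G ⟨l - 1, by omega⟩) = bhatt W ^ k := by
  subst hk
  have hi : IsTop (⟨l - 1, by omega⟩ : Fin l) := fun j => Fin.le_def.2 (by dsimp only; omega)
  constructor
  · rw [mutualInfo_eq_outputSum, mutualInfo_eq_outputSum]
    exact outputSum_splitChannel_of_isTop (fun c a b _ => mutualInfoTerm_mul c a b) hW hsym G hi
  · rw [← bhatt_prodChannel hW.1]
    exact outputSum_splitChannel_of_isTop (f := fun a b => √(a * b))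
      (fun _ a b hc => sqrt_mul_mul_mul hc a b) hW hsym G hi
end

section
/- Let W be a B-DMC and G an invertible ℓ×ℓ matrix over GF(2) whose last row is (0,…,0,1). Let G^{(ℓ−1)} denote the (ℓ−1)×(ℓ−1) matrix obtained from G by removing its last row and last column, and let V^{(i)}, i = 1,…,ℓ−1, denote the split channels defined from W and G^{(ℓ−1)}. Then for every i ∈ {1,…,ℓ−1}, all y₁^ℓ ∈ 𝒴^ℓ, u₁^{i−1} ∈ {0,1}^{i−1} and u_i ∈ {0,1}: W^{(i)}(y₁^ℓ, u₁^{i−1} | u_i) = (1/2)·(W(y_ℓ|0) + W(y_ℓ|1)) · V^{(i)}(y₁^{ℓ−1}, u₁^{i−1} | u_i). -/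
open scoped BigOperators

theorem sum_zmod_two_add_left (f : ZMod 2 → ℝ) (c : ZMod 2) :
    ∑ a, f (c + a) = f 0 + f 1 := by
  exact (Equiv.sum_comp (Equiv.addLeft c) f).trans <| Fin.sum_univ_two f

theorem vecMul_snoc_last {n : ℕ} (G : Matrix (Fin (n + 1)) (Fin (n + 1)) (ZMod 2))
    (hlast : ∀ j, G (Fin.last n) j = if j = Fin.last n then 1 else 0)
    (u : Fin n → ZMod 2) (a : ZMod 2) :
    Matrix.vecMul (Fin.snoc u a : Fin (n + 1) → ZMod 2) G (Fin.last n) =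
      ∑ i, u i * G i.castSucc (Fin.last n) + a := by
  simp [Matrix.vecMul, dotProduct, Fin.sum_univ_castSucc, hlast]

theorem vecMul_snoc_castSucc {n : ℕ} (G : Matrix (Fin (n + 1)) (Fin (n + 1)) (ZMod 2))
    (hlast : ∀ j, G (Fin.last n) j = if j = Fin.last n then 1 else 0)
    (u : Fin n → ZMod 2) (a : ZMod 2) (j : Fin n) :
    Matrix.vecMul (Fin.snoc u a : Fin (n + 1) → ZMod 2) G j.castSucc =
      Matrix.vecMul u (Matrix.of fun i k : Fin n => G i.castSucc k.castSucc) j := by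
  simp [Matrix.vecMul, dotProduct, Fin.sum_univ_castSucc, hlast, Fin.castSucc_ne_last]

theorem splitChannel_castSucc {Y : Type} [Fintype Y] {n : ℕ} (W : ZMod 2 → Y → ℝ)
    (G : Matrix (Fin (n + 1)) (Fin (n + 1)) (ZMod 2))
    (hlast : ∀ j, G (Fin.last n) j = if j = Fin.last n then 1 else 0)
    (i : Fin n) (ui : ZMod 2) (y : Fin (n + 1) → Y) (up : Fin i.val → ZMod 2) :
    splitChannel W G i.castSucc ui (y, up) =
      (1 / 2) * (W 0 (y (Fin.last n)) + W 1 (y (Fin.last n))) *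
        splitChannel W (Matrix.of fun a b : Fin n => G a.castSucc b.castSucc)
          i ui (fun j => y j.castSucc, up) := by
  have hpow : (1 : ℝ) / 2 ^ (n + 1 - 1) = 1 / 2 * (1 / 2 ^ (n - 1)) := by
    obtain ⟨k, rfl⟩ : ∃ k, n = k + 1 := ⟨n - 1, by have := i.isLt; omega⟩
    simp only [Nat.add_sub_cancel, pow_succ]
    ring
  have hpast (u : Fin n → ZMod 2) (a : ZMod 2) (j : Fin i.val) :
      (Fin.snoc u a : Fin (n + 1) → ZMod 2) (Fin.castLE i.castSucc.isLt.le j) =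
        u (Fin.castLE i.isLt.le j) :=
    Fin.snoc_castSucc (α := fun _ => ZMod 2) a u (Fin.castLE i.isLt.le j)
  have hcond (u : Fin n → ZMod 2) (a : ZMod 2) :
      ((Fin.snoc u a : Fin (n + 1) → ZMod 2) i.castSucc = ui ∧
        ∀ j : Fin i.castSucc.val,
          (Fin.snoc u a : Fin (n + 1) → ZMod 2) (Fin.castLE i.castSucc.isLt.le j) = up j) ↔
      (u i = ui ∧ ∀ j : Fin i.val, u (Fin.castLE i.isLt.le j) = up j) := by
    rw [Fin.snoc_castSucc (α := fun _ => ZMod 2)]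
    exact and_congr_right fun _ => forall_congr' fun j => by rw [← hpast u a j]
  unfold splitChannel
  dsimp only
  rw [hpow, mul_assoc, mul_assoc, mul_left_comm (W 0 _ + W 1 _)]
  congr 2
  rw [Finset.sum_filter, ← (Fin.snocEquiv fun _ : Fin (n + 1) => ZMod 2).sum_comp,
    Fintype.sum_prod_type, Finset.sum_comm, Finset.sum_filter, Finset.mul_sum]
  refine Finset.sum_congr rfl fun u _ => ?_
  rw [mul_ite, mul_zero]
  have hterm (a : ZMod 2) :
      ∏ j, W (Matrix.vecMul (Fin.snoc u a : Fin (n + 1) → ZMod 2) G j) (y j) =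
        (∏ j : Fin n, W (Matrix.vecMul u
          (Matrix.of fun i k : Fin n => G i.castSucc k.castSucc) j) (y j.castSucc)) *
        W (∑ i, u i * G i.castSucc (Fin.last n) + a) (y (Fin.last n)) := by
    rw [Fin.prod_univ_castSucc, vecMul_snoc_last G hlast]
    simp only [vecMul_snoc_castSucc G hlast]
  change ∑ a : ZMod 2, (if ((Fin.snoc u a : Fin (n + 1) → ZMod 2) i.castSucc = ui ∧
        ∀ j : Fin i.castSucc.val,
          (Fin.snoc u a : Fin (n + 1) → ZMod 2) (Fin.castLE i.castSucc.isLt.le j) = up j) then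
      ∏ j, W (Matrix.vecMul (Fin.snoc u a : Fin (n + 1) → ZMod 2) G j) (y j) else 0) = _
  simp only [hcond, hterm]
  split_ifs
  · rw [← Finset.mul_sum,
      sum_zmod_two_add_left (fun x => W x (y (Fin.last n))), mul_comm]
  · simp

/-- If the last row of `G` is `(0,…,0,1)`, then for `i = 1,…,ℓ-1` the split
channels of `G` factor as the split channels of the minor `G^{(ℓ-1)}` times the uninformative
factor `(W(y_ℓ|0)+W(y_ℓ|1))/2`. -/
theorem splitChannel_factor_of_lastRow_unit {Y : Type} [Fintype Y] {l : ℕ} (hl : 0 < l)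
    (W : ZMod 2 → Y → ℝ) (hW : IsBDMC W)
    (G : Matrix (Fin l) (Fin l) (ZMod 2)) (hGinv : IsUnit G.det)
    (hlast : ∀ j : Fin l, G ⟨l - 1, by omega⟩ j = if j = ⟨l - 1, by omega⟩ then 1 else 0)
    (i : Fin (l - 1)) (ui : ZMod 2) (y : Fin l → Y) (up : Fin i.val → ZMod 2) :
    splitChannel W G (Fin.castLE (by omega) i) ui (y, up) =
      (1 / 2) * (W 0 (y ⟨l - 1, by omega⟩) + W 1 (y ⟨l - 1, by omega⟩)) *
        splitChannel W
          (Matrix.of fun a b : Fin (l - 1) =>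
            G (Fin.castLE (by omega) a) (Fin.castLE (by omega) b))
          i ui (fun j => y (Fin.castLE (by omega) j), up) := by
  obtain ⟨n, rfl⟩ : ∃ n, l = n + 1 := ⟨l - 1, by omega⟩
  exact splitChannel_castSucc W G hlast i ui y up
end
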